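/- Let A₃ be the level-3 Schreier adjacency matrix of the Basilica group, i.e., the 8×8 integer matrix indexed by binary words of length 3 with A₃(u,v) = #{s ∈ {a,a⁻¹,b,b⁻¹} : s(u) = v}. Then, as an identity of polynomials in t over ℤ, det(I₈ − t·A₃ + 3t²·I₈) = (t−1)(3t−1)(3t²+1)(3t²−2t+1)(9t⁴−2t²+1)(27t⁶−18t⁵+3t⁴−4t³+t²−2t+1). (This is the determinant factor in the Ihara–Bass formula for the Ihara zeta function of the level-3 Schreier graph Γ₃ of the Basilica group, computed via the Artin L-functions of the ℤ/2ℤ-Galois covering Γ₃|Γ₂.) -/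

import Mathlib

mutual
/-- The generator `a` of the Basilica group: `a(0w)=0·b(w)`, `a(1w)=1·w`. -/
def basA : List (Fin 2) → List (Fin 2)
  | [] => []
  | x :: w => if x = 0 then 0 :: basB w else 1 :: w
/-- The generator `b`: `b(0w)=1·a(w)`, `b(1w)=0·w`. -/
def basB : List (Fin 2) → List (Fin 2)
  | [] => []
  | x :: w => if x = 0 then 1 :: basA w else 0 :: w
end

mutual
/-- The inverse generator `a⁻¹`: `a⁻¹(0w)=0·b⁻¹(w)`, `a⁻¹(1w)=1·w`. -/
def basAinv : List (Fin 2) → List (Fin 2)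
  | [] => []
  | x :: w => if x = 0 then 0 :: basBinv w else 1 :: w
/-- The inverse generator `b⁻¹`: `b⁻¹(1w)=0·a⁻¹(w)`, `b⁻¹(0w)=1·w`. -/
def basBinv : List (Fin 2) → List (Fin 2)
  | [] => []
  | x :: w => if x = 1 then 0 :: basAinv w else 1 :: w
end

open Polynomial

/-- The generating set `{a, a⁻¹, b, b⁻¹}` of the Basilica group. -/
def basGens : List (List (Fin 2) → List (Fin 2)) := [basA, basAinv, basB, basBinv]

/-- The level-3 Schreier adjacency matrix `A₃` of the Basilica group, indexed by
binary words `u₁u₂u₃` of length 3: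
`A₃(u,v) = #{s ∈ {a,a⁻¹,b,b⁻¹} : s(u) = v}`. -/
def basAdj3 : Matrix (Fin 2 × Fin 2 × Fin 2) (Fin 2 × Fin 2 × Fin 2) ℤ :=
  fun u v =>
    (basGens.countP (fun s => decide (s [u.1, u.2.1, u.2.2] = [v.1, v.2.1, v.2.2])) : ℤ)

/-- The determinant of a block matrix commuting with the swap of its two blocks splits into the
factors of the trivial and of the sign character of `ℤ/2ℤ`. -/
theorem Matrix.det_fromBlocks_swap_invariant {n R : Type*} [Fintype n] [DecidableEq n]
    [CommRing R] (A B : Matrix n n R) :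
    (Matrix.fromBlocks A B B A).det = (A + B).det * (A - B).det := by
  have h : Matrix.fromBlocks 1 1 0 1 * Matrix.fromBlocks A B B A
      * Matrix.fromBlocks 1 (-1) 0 1 = Matrix.fromBlocks (A + B) 0 B (A - B) := by
    simp only [Matrix.fromBlocks_multiply]
    congr 1 <;> simp <;> abel
  have h' := congrArg Matrix.det h
  simpa only [Matrix.det_mul, Matrix.det_fromBlocks_zero₂₁, Matrix.det_fromBlocks_zero₁₂,
    Matrix.det_one, one_mul, mul_one] using h'

/-- Binary words of length 3, split according to their last letter (the sheets of the covering
`Γ₃ → Γ₂`). -/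
def basWordsEquiv : Fin 4 ⊕ Fin 4 ≃ Fin 2 × Fin 2 × Fin 2 where
  toFun := Sum.elim (fun i => (i.divNat (n := 2) (m := 2), i.modNat (n := 2) (m := 2), 0))
    (fun i => (i.divNat (n := 2) (m := 2), i.modNat (n := 2) (m := 2), 1))
  invFun u := if u.2.2 = 0 then .inl (finProdFinEquiv (u.1, u.2.1))
    else .inr (finProdFinEquiv (u.1, u.2.1))
  left_inv := by decide
  right_inv := by decide

/-- In the order of `basWordsEquiv`, the matrix `A₃` is invariant under swapping the sheets. -/
theorem basAdj3_submatrix :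
    basAdj3.submatrix basWordsEquiv basWordsEquiv =
      Matrix.fromBlocks !![0, 2, 1, 0; 2, 0, 0, 2; 1, 0, 2, 0; 0, 2, 0, 2]
        !![0, 0, 1, 0; 0, 0, 0, 0; 1, 0, 0, 0; 0, 0, 0, 0]
        !![0, 0, 1, 0; 0, 0, 0, 0; 1, 0, 0, 0; 0, 0, 0, 0]
        !![0, 2, 1, 0; 2, 0, 0, 2; 1, 0, 2, 0; 0, 2, 0, 2] := by
  decide

/-- The determinant factor in the Ihara–Bass formula for the Ihara zeta function of
the level-3 Schreier graph `Γ₃` of the Basilica group: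
`det(I₈ − t·A₃ + 3t²·I₈) =
(t−1)(3t−1)(3t²+1)(3t²−2t+1)(9t⁴−2t²+1)(27t⁶−18t⁵+3t⁴−4t³+t²−2t+1)`. -/
theorem basilica_level3_ihara_det :
    Matrix.det
      ((1 : Matrix (Fin 2 × Fin 2 × Fin 2) (Fin 2 × Fin 2 × Fin 2) (Polynomial ℤ))
        - (X : Polynomial ℤ) • (basAdj3.map C)
        + (3 * X ^ 2 : Polynomial ℤ) •
            (1 : Matrix (Fin 2 × Fin 2 × Fin 2) (Fin 2 × Fin 2 × Fin 2) (Polynomial ℤ)))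
      = (X - 1) * (3 * X - 1) * (3 * X ^ 2 + 1) * (3 * X ^ 2 - 2 * X + 1)
        * (9 * X ^ 4 - 2 * X ^ 2 + 1)
        * (27 * X ^ 6 - 18 * X ^ 5 + 3 * X ^ 4 - 4 * X ^ 3 + X ^ 2 - 2 * X + 1) := by
  rw [← Matrix.det_submatrix_equiv_self basWordsEquiv]
  have h : ((1 : Matrix (Fin 2 × Fin 2 × Fin 2) (Fin 2 × Fin 2 × Fin 2) (Polynomial ℤ))
        - (X : Polynomial ℤ) • (basAdj3.map C)
        + (3 * X ^ 2 : Polynomial ℤ) • 1).submatrix basWordsEquiv basWordsEquiv =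
      1 - (X : Polynomial ℤ) • ((basAdj3.submatrix basWordsEquiv basWordsEquiv).map C)
        + (3 * X ^ 2 : Polynomial ℤ) • 1 := by
    rw [← Matrix.submatrix_one_equiv basWordsEquiv]
    rfl
  rw [h, basAdj3_submatrix, ← Matrix.fromBlocks_one, Matrix.fromBlocks_map,
    Matrix.fromBlocks_smul, Matrix.fromBlocks_smul, sub_eq_add_neg, Matrix.fromBlocks_neg,
    Matrix.fromBlocks_add, Matrix.fromBlocks_add, zero_add, smul_zero, add_zero,
    Matrix.det_fromBlocks_swap_invariant]
  simp [Matrix.det_succ_row_zero, Fin.sum_univ_succ, Fin.succAbove, Matrix.one_apply]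
  ring
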